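/- Fix real constants c > 0 and λ ≥ 1. For each N let G(N, ⌊cN⌋) be the Erdős–Rényi directed multigraph on [N] with ⌊cN⌋ edges, and let Z_N = Σ_S λ^{|S|}, the sum over all independent sets S ⊆ [N] of G(N, ⌊cN⌋) (including the empty set). Then there exists a constant z(c) such that N^{−1} log Z_N converges to z(c) with high probability as N → ∞. -/

import Mathlib

open Filter
open scoped Classical

/-- Probability of an event `p` when an edge list of `M` directed edges on vertex set
`Fin N` is drawn uniformly at random (i.e. the `M` edges are i.i.d. uniform ordered pairs). -/
noncomputable def probER (N M : ℕ) (p : (Fin M → Fin N × Fin N) → Prop) : ℝ :=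
  (((Finset.univ : Finset (Fin M → Fin N × Fin N)).filter p).card : ℝ) /
    (Fintype.card (Fin M → Fin N × Fin N) : ℝ)

/-- `S` is an independent set for the edge list `E`: no edge has both endpoints in `S`. -/
def IsIndepSet {N M : ℕ} (E : Fin M → Fin N × Fin N) (S : Finset (Fin N)) : Prop :=
  ∀ m : Fin M, ¬((E m).1 ∈ S ∧ (E m).2 ∈ S)

/-- The hard-core partition function `Z(G) = Σ_{S independent} λ^{|S|}` (the empty set is
included). -/
noncomputable def hardCoreZ (lam : ℝ) {N M : ℕ} (E : Fin M → Fin N × Fin N) : ℝ :=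
  ∑ S ∈ (Finset.univ : Finset (Finset (Fin N))).filter (IsIndepSet E), lam ^ S.card

section InsertAvg

variable {X Y : Type*} [Fintype X] [DecidableEq X] [Fintype Y] [DecidableEq Y]

/-- The operator on functions of finite edge sets which inserts one edge drawn with weights `μ`. -/
noncomputable def insertAvg (μ : X → ℝ) : Module.End ℝ (Finset X → ℝ) where
  toFun f E := ∑ e, μ e * f (insert e E)
  map_add' f g := by ext E; simp [mul_add, Finset.sum_add_distrib]
  map_smul' r f := by ext E; simp [Finset.mul_sum, mul_left_comm]

theorem insertAvg_apply (μ : X → ℝ) (f : Finset X → ℝ) (E : Finset X) :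
    insertAvg μ f E = ∑ e, μ e * f (insert e E) := rfl

theorem insertAvg_commute (μ ν : X → ℝ) : Commute (insertAvg μ) (insertAvg ν) := by
  refine LinearMap.ext fun f => funext fun E => ?_
  simp only [Module.End.mul_apply, insertAvg_apply, Finset.mul_sum]
  rw [Finset.sum_comm]
  refine Finset.sum_congr rfl fun e _ => Finset.sum_congr rfl fun e' _ => ?_
  rw [Finset.insert_comm, mul_left_comm]

theorem insertAvg_pow_mono_on {μ : X → ℝ} (hμ : ∀ e, 0 ≤ μ e) {Q : X → Prop}
    (hQ : ∀ e, μ e ≠ 0 → Q e) {f g : Finset X → ℝ}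
    (hfg : ∀ E : Finset X, (∀ e ∈ E, Q e) → f E ≤ g E) (M : ℕ) :
    ∀ E : Finset X, (∀ e ∈ E, Q e) → (insertAvg μ ^ M) f E ≤ (insertAvg μ ^ M) g E := by
  induction M with
  | zero => simpa using hfg
  | succ M ih =>
    intro E hE
    simp only [pow_succ', Module.End.mul_apply, insertAvg_apply]
    refine Finset.sum_le_sum fun e _ => ?_
    by_cases he : μ e = 0
    · simp [he]
    · refine mul_le_mul_of_nonneg_left (ih _ ?_) (hμ e)
      simpa using ⟨hQ e he, hE⟩

theorem insertAvg_pow_mono {μ : X → ℝ} (hμ : ∀ e, 0 ≤ μ e) {f g : Finset X → ℝ} (hfg : f ≤ g)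
    (M : ℕ) : (insertAvg μ ^ M) f ≤ (insertAvg μ ^ M) g := fun E =>
  insertAvg_pow_mono_on hμ (Q := fun _ => True) (by simp) (fun E _ => hfg E) M E (by simp)

theorem insertAvg_pow_const {μ : X → ℝ} (h1 : ∑ e, μ e = 1) (r : ℝ) (M : ℕ) :
    (insertAvg μ ^ M) (fun _ => r) = fun _ => r := by
  induction M with
  | zero => simp
  | succ M ih =>
    rw [pow_succ, Module.End.mul_apply]
    convert ih using 2
    ext E
    rw [insertAvg_apply, ← Finset.sum_mul, h1, one_mul]

theorem insertAvg_pow_le_insertAvg_pow {μ ν : X → ℝ} (hμ : ∀ e, 0 ≤ μ e) (hν : ∀ e, 0 ≤ ν e)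
    {f : Finset X → ℝ} (h : insertAvg ν f ≤ insertAvg μ f) (M : ℕ) :
    (insertAvg ν ^ M) f ≤ (insertAvg μ ^ M) f := by
  induction M with
  | zero => simp
  | succ M ih =>
    calc (insertAvg ν ^ (M + 1)) f = (insertAvg ν ^ 1) ((insertAvg ν ^ M) f) := by
          rw [pow_succ', Module.End.mul_apply, pow_one]
      _ ≤ (insertAvg ν ^ 1) ((insertAvg μ ^ M) f) := insertAvg_pow_mono hν ih 1
      _ = (insertAvg μ ^ M) (insertAvg ν f) := by
          rw [← Module.End.mul_apply, ← Module.End.mul_apply, pow_one,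
            ((insertAvg_commute ν μ).pow_right M).eq]
      _ ≤ (insertAvg μ ^ M) (insertAvg μ f) := insertAvg_pow_mono hμ h M
      _ = _ := by rw [pow_succ, Module.End.mul_apply]

theorem insertAvg_pow_image {μ : X → ℝ} {ν : Y → ℝ} {ψ : X → Y}
    (hψ : ∀ F : Y → ℝ, ∑ y, ν y * F y = ∑ x, μ x * F (ψ x)) (f : Finset Y → ℝ) (M : ℕ)
    (E : Finset X) :
    (insertAvg ν ^ M) f (E.image ψ) = (insertAvg μ ^ M) (fun E => f (E.image ψ)) E := by
  induction M generalizing E with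
  | zero => simp
  | succ M ih =>
    simp only [pow_succ', Module.End.mul_apply, insertAvg_apply]
    rw [hψ]
    refine Finset.sum_congr rfl fun e _ => ?_
    rw [← ih, Finset.image_insert]

theorem insertAvg_const_pow_eq_sum (r : ℝ) (f : Finset X → ℝ) (M : ℕ) (E₀ : Finset X) :
    (insertAvg (fun _ => r) ^ M) f E₀ =
      r ^ M * ∑ E : Fin M → X, f (E₀ ∪ Finset.univ.image E) := by
  induction M generalizing E₀ with
  | zero => simp
  | succ M ih =>
    simp only [pow_succ', Module.End.mul_apply, insertAvg_apply, ih]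
    rw [← (Fin.consEquiv fun _ => X).sum_comp, Fintype.sum_prod_type, ← Finset.mul_sum,
      ← Finset.mul_sum, ← mul_assoc]
    congr 1
    refine Finset.sum_congr rfl fun e _ => Finset.sum_congr rfl fun E _ => ?_
    congr 1
    ext x
    simp [Fin.exists_fin_succ, Fin.consEquiv]
    tauto

theorem le_insertAvg_pow_of_le_add {μ : X → ℝ} (hμ : ∀ e, 0 ≤ μ e) (h1 : ∑ e, μ e = 1)
    {f g : Finset X → ℝ} {r : ℝ} (h : ∀ E, f E ≤ g E + r) (M : ℕ) (E : Finset X) :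
    (insertAvg μ ^ M) f E ≤ (insertAvg μ ^ M) g E + r := by
  have := insertAvg_pow_mono hμ (f := f) (g := g + fun _ => r) h M E
  rwa [map_add, insertAvg_pow_const h1] at this

variable {μ : X → ℝ} {K : ℝ} {g : Finset X → ℝ}

theorem abs_insertAvg_sub_le (hμ : ∀ e, 0 ≤ μ e) (h1 : ∑ e, μ e = 1)
    (hg : ∀ e E, |g (insert e E) - g E| ≤ K) (E : Finset X) : |insertAvg μ g E - g E| ≤ K := by
  have : insertAvg μ g E - g E = ∑ e, μ e * (g (insert e E) - g E) := by
    simp only [mul_sub, Finset.sum_sub_distrib, ← Finset.sum_mul, h1, one_mul, insertAvg_apply]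
  rw [this]
  calc |∑ e, μ e * (g (insert e E) - g E)| ≤ ∑ e, |μ e * (g (insert e E) - g E)| :=
        Finset.abs_sum_le_sum_abs _ _
    _ ≤ ∑ e, μ e * K := by
        refine Finset.sum_le_sum fun e _ => ?_
        rw [abs_mul, abs_of_nonneg (hμ e)]
        exact mul_le_mul_of_nonneg_left (hg e E) (hμ e)
    _ = K := by rw [← Finset.sum_mul, h1, one_mul]

theorem abs_insertAvg_pow_sub_le (hμ : ∀ e, 0 ≤ μ e) (h1 : ∑ e, μ e = 1)
    (hg : ∀ e E, |g (insert e E) - g E| ≤ K) (m m' : ℕ) (E : Finset X) :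
    |(insertAvg μ ^ m) g E - (insertAvg μ ^ m') g E| ≤ K * |(m : ℝ) - m'| := by
  have step : ∀ m, |(insertAvg μ ^ (m + 1)) g E - (insertAvg μ ^ m) g E| ≤ K := fun m => by
    have h := fun E => abs_le.1 (abs_insertAvg_sub_le hμ h1 hg E)
    rw [pow_succ, Module.End.mul_apply, abs_le]
    have h₁ := le_insertAvg_pow_of_le_add hμ h1 (f := g) (g := insertAvg μ g) (r := K)
      (fun E => by linarith [(h E).1]) m E
    have h₂ := le_insertAvg_pow_of_le_add hμ h1 (f := insertAvg μ g) (g := g) (r := K)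
      (fun E => by linarith [(h E).2]) m E
    constructor <;> linarith
  have key : ∀ m d : ℕ,
      |(insertAvg μ ^ (m + d)) g E - (insertAvg μ ^ m) g E| ≤ K * d := fun m d => by
    induction d with
    | zero => simp
    | succ d ih =>
      have := abs_le.1 (step (m + d))
      have ih := abs_le.1 ih
      rw [← add_assoc, abs_le]
      push_cast
      constructor <;> linarith
  rcases le_total m' m with h | h
  · obtain ⟨d, rfl⟩ := Nat.exists_eq_add_of_le h
    simpa using key m' d
  · obtain ⟨d, rfl⟩ := Nat.exists_eq_add_of_le h
    rw [abs_sub_comm]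
    simpa using key m d

theorem insertAvg_pow_sq_le (hμ : ∀ e, 0 ≤ μ e) (h1 : ∑ e, μ e = 1)
    (hg : ∀ e E, |g (insert e E) - g E| ≤ K) (M : ℕ) (E : Finset X) :
    (insertAvg μ ^ M) (fun E => g E ^ 2) E ≤ ((insertAvg μ ^ M) g E) ^ 2 + M * K ^ 2 := by
  induction M generalizing g with
  | zero => simp
  | succ M ih =>
    have hlip : ∀ e E, |insertAvg μ g (insert e E) - insertAvg μ g E| ≤ K := fun e E => by
      have : insertAvg μ g (insert e E) - insertAvg μ g E =
          ∑ e', μ e' * (g (insert e (insert e' E)) - g (insert e' E)) := by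
        simp only [mul_sub, Finset.sum_sub_distrib, insertAvg_apply, Finset.insert_comm e]
      rw [this]
      calc |∑ e', μ e' * (g (insert e (insert e' E)) - g (insert e' E))|
          ≤ ∑ e', |μ e' * (g (insert e (insert e' E)) - g (insert e' E))| :=
            Finset.abs_sum_le_sum_abs _ _
        _ ≤ ∑ e', μ e' * K := by
            refine Finset.sum_le_sum fun e' _ => ?_
            rw [abs_mul, abs_of_nonneg (hμ e')]
            exact mul_le_mul_of_nonneg_left (hg _ _) (hμ _)
        _ = K := by rw [← Finset.sum_mul, h1, one_mul]
    have hvar : ∀ E, insertAvg μ (fun E => g E ^ 2) E ≤ insertAvg μ g E ^ 2 + K ^ 2 := fun E => by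
      have h₁ : ∑ e, μ e * (g (insert e E) - g E) ^ 2 ≤ ∑ e, μ e * K ^ 2 :=
        Finset.sum_le_sum fun e _ => mul_le_mul_of_nonneg_left
          (sq_le_sq' (abs_le.1 (hg e E)).1 (abs_le.1 (hg e E)).2) (hμ e)
      rw [← Finset.sum_mul, h1, one_mul] at h₁
      have h₂ : ∑ e, μ e * (g (insert e E) - g E) ^ 2 =
          insertAvg μ (fun E => g E ^ 2) E - 2 * g E * insertAvg μ g E + g E ^ 2 := by
        calc _ = ∑ e, (μ e * g (insert e E) ^ 2 - 2 * g E * (μ e * g (insert e E)) +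
              μ e * g E ^ 2) := Finset.sum_congr rfl fun e _ => by ring
          _ = _ := by
            rw [Finset.sum_add_distrib, Finset.sum_sub_distrib, ← Finset.mul_sum,
              ← Finset.sum_mul, h1, one_mul, insertAvg_apply, insertAvg_apply]
      nlinarith [sq_nonneg (insertAvg μ g E - g E)]
    have h₁ := le_insertAvg_pow_of_le_add hμ h1 hvar M E
    have h₂ := ih hlip
    rw [pow_succ, Module.End.mul_apply, Module.End.mul_apply]
    push_cast
    linarith

theorem insertAvg_pow_sub_mean_sq_le (hμ : ∀ e, 0 ≤ μ e) (h1 : ∑ e, μ e = 1)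
    (hg : ∀ e E, |g (insert e E) - g E| ≤ K) (M : ℕ) (E : Finset X) :
    (insertAvg μ ^ M) (fun E' => (g E' - (insertAvg μ ^ M) g E) ^ 2) E ≤ M * K ^ 2 := by
  set a := (insertAvg μ ^ M) g E with ha
  have h : (fun E' => (g E' - a) ^ 2) =
      (fun E' => g E' ^ 2) - (2 * a) • g + fun _ => a ^ 2 := by
    ext E'
    simp only [Pi.add_apply, Pi.sub_apply, Pi.smul_apply, smul_eq_mul]
    ring
  have := insertAvg_pow_sq_le hμ h1 hg M E
  rw [h, map_add, map_sub, map_smul, insertAvg_pow_const h1]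
  simp only [Pi.add_apply, Pi.sub_apply, Pi.smul_apply, smul_eq_mul, ← ha] at this ⊢
  linarith

theorem pow_apply_eq_pow_apply_of_commute {R W : Type*} [Semiring R] [AddCommMonoid W] [Module R W]
    {A B : Module.End R W} (hAB : Commute A B) {w : W} (h : A w = B w) (M : ℕ) :
    (A ^ M) w = (B ^ M) w := by
  induction M with
  | zero => simp
  | succ M ih =>
    rw [pow_succ, Module.End.mul_apply, h, ← Module.End.mul_apply, (hAB.pow_left M).eq,
      Module.End.mul_apply, ih, ← Module.End.mul_apply, ← pow_succ']

/-- Iterating an insertion performed with probability `p` loses at most the mean deviation of the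
binomial number of insertions from `m₀`, estimated through its variance. -/
theorem lazy_insertAvg_pow_ge (hμ : ∀ e, 0 ≤ μ e) (h1 : ∑ e, μ e = 1) (hK : 0 ≤ K)
    (hg : ∀ e E, |g (insert e E) - g E| ≤ K) {p : ℝ} (hp0 : 0 ≤ p) (hp1 : p ≤ 1) (M m₀ : ℕ)
    {s : ℝ} (hs : 0 < s) (E : Finset X) :
    (insertAvg μ ^ m₀) g E - K * (M * p / (2 * s) + s / 2 + |M * p - m₀|) ≤
      ((p • insertAvg μ + (1 - p) • (1 : Module.End ℝ (Finset X → ℝ))) ^ M) g E := by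
  set h : ℕ → ℝ := fun m => (insertAvg μ ^ m) g E with hh
  set w : ℕ → ℝ := fun m => (bernsteinPolynomial ℝ M m).eval p with hw
  have hcomm : Commute (p • insertAvg μ) ((1 - p) • (1 : Module.End ℝ (Finset X → ℝ))) :=
    ((Commute.one_right _).smul_right _).smul_left _
  have hexp : ((p • insertAvg μ + (1 - p) • (1 : Module.End ℝ (Finset X → ℝ))) ^ M) g E =
      ∑ m ∈ Finset.range (M + 1), w m * h m := by
    rw [hcomm.add_pow, LinearMap.sum_apply, Finset.sum_apply]
    refine Finset.sum_congr rfl fun m _ => ?_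
    simp only [smul_pow, one_pow, hw, hh, bernsteinPolynomial, ← nsmul_eq_mul']
    simp
    ring
  have hw0 : ∀ m, 0 ≤ w m := fun m => by
    simp only [hw, bernsteinPolynomial]
    have := sub_nonneg.2 hp1
    simp
    positivity
  have hw1 : ∑ m ∈ Finset.range (M + 1), w m = 1 := by
    have := congrArg (Polynomial.eval p) (bernsteinPolynomial.sum ℝ M)
    simpa [Polynomial.eval_finsetSum] using this
  have hw2 : ∑ m ∈ Finset.range (M + 1), w m * (M * p - m) ^ 2 = M * p * (1 - p) := by
    have := congrArg (Polynomial.eval p) (bernsteinPolynomial.variance ℝ M)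
    simpa [Polynomial.eval_finsetSum, mul_comm] using this
  have hb : ∀ m : ℕ, h m₀ - K * ((M * p - m) ^ 2 / (2 * s) + s / 2 + |M * p - m₀|) ≤ h m :=
    fun m => by
      have h₁ := (abs_le.1 (abs_insertAvg_pow_sub_le hμ h1 hg m m₀ E)).1
      have h₂ : |(m : ℝ) - m₀| ≤ |M * p - m| + |M * p - m₀| := by
        have := abs_sub_le (m : ℝ) (M * p) m₀
        rwa [abs_sub_comm (m : ℝ) (M * p)] at this
      have h₃ : |M * p - m| ≤ (M * p - m) ^ 2 / (2 * s) + s / 2 := by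
        rw [← sq_abs, ← sub_nonneg]
        have : |M * p - m| ^ 2 / (2 * s) + s / 2 - |M * p - m| =
            (|M * p - m| - s) ^ 2 / (2 * s) := by field_simp; ring
        rw [this]; positivity
      have h₄ : K * |(m : ℝ) - m₀| ≤ K * ((M * p - m) ^ 2 / (2 * s) + s / 2 + |M * p - m₀|) :=
        mul_le_mul_of_nonneg_left (by linarith) hK
      simp only [hh]
      linarith
  rw [hexp]
  have h₁ : ∑ m ∈ Finset.range (M + 1),
        w m * (h m₀ - K * ((M * p - m) ^ 2 / (2 * s) + s / 2 + |M * p - m₀|)) ≤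
      ∑ m ∈ Finset.range (M + 1), w m * h m :=
    Finset.sum_le_sum fun m _ => mul_le_mul_of_nonneg_left (hb m) (hw0 m)
  have h₂ : ∑ m ∈ Finset.range (M + 1),
        w m * (h m₀ - K * ((M * p - m) ^ 2 / (2 * s) + s / 2 + |M * p - m₀|)) =
      h m₀ - K * (M * p * (1 - p) / (2 * s) + s / 2 + |M * p - m₀|) := by
    calc _ = ∑ m ∈ Finset.range (M + 1), (w m * (h m₀ - K * (s / 2 + |M * p - m₀|)) -
          w m * (M * p - m) ^ 2 * (K / (2 * s))) := Finset.sum_congr rfl fun m _ => by ring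
      _ = _ := by
        rw [Finset.sum_sub_distrib, ← Finset.sum_mul, ← Finset.sum_mul, hw1, hw2]; ring
  have h₃ : M * p * (1 - p) / (2 * s) ≤ M * p / (2 * s) := by
    have : 0 ≤ M * p * p := by positivity
    exact div_le_div_of_nonneg_right (by linarith) (by positivity)
  have h₄ : K * (M * p * (1 - p) / (2 * s) + s / 2 + |M * p - m₀|) ≤
      K * (M * p / (2 * s) + s / 2 + |M * p - m₀|) :=
    mul_le_mul_of_nonneg_left (by linarith) hK
  change h m₀ - _ ≤ _
  linarith

end InsertAvg

section RestrictedZ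

variable {V W : Type*}

/-- No edge in `E` has both endpoints in `S`. -/
def IsIndepFor (E : Finset (V × V)) (S : Finset V) : Prop :=
  ∀ e ∈ E, ¬(e.1 ∈ S ∧ e.2 ∈ S)

/-- The hard-core partition function restricted to independent subsets of `U`. -/
noncomputable def restrictedZ (lam : ℝ) (U : Finset V) (E : Finset (V × V)) : ℝ :=
  ∑ S ∈ U.powerset with IsIndepFor E S, lam ^ S.card

theorem hardCoreZ_eq_restrictedZ {N M : ℕ} (lam : ℝ) (E : Fin M → Fin N × Fin N) :
    hardCoreZ lam E = restrictedZ lam Finset.univ (Finset.univ.image E) := by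
  unfold hardCoreZ restrictedZ
  refine Finset.sum_congr ?_ fun _ _ => rfl
  ext S
  simp [IsIndepSet, IsIndepFor]

variable {lam : ℝ}

theorem one_le_restrictedZ (hlam : 0 ≤ lam) (U : Finset V) (E : Finset (V × V)) :
    1 ≤ restrictedZ lam U E := by
  have : lam ^ (∅ : Finset V).card ≤ restrictedZ lam U E :=
    Finset.single_le_sum (f := fun S : Finset V => lam ^ S.card) (fun S _ => by positivity)
      (by simp [IsIndepFor])
  simpa using this

theorem restrictedZ_le (hlam : 0 ≤ lam) (U : Finset V) (E : Finset (V × V)) :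
    restrictedZ lam U E ≤ (1 + lam) ^ U.card := by
  calc restrictedZ lam U E ≤ ∑ S ∈ U.powerset, lam ^ S.card :=
        Finset.sum_le_sum_of_subset_of_nonneg (Finset.filter_subset _ _)
          fun S _ _ => by positivity
    _ = _ := by
        rw [add_comm 1 lam, ← Finset.sum_pow_mul_eq_add_pow]
        simp

theorem restrictedZ_mono (hlam : 0 ≤ lam) {U U' : Finset V} (h : U ⊆ U') (E : Finset (V × V)) :
    restrictedZ lam U E ≤ restrictedZ lam U' E := by
  refine Finset.sum_le_sum_of_subset_of_nonneg ?_ fun S _ _ => by positivity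
  exact Finset.filter_subset_filter _ (Finset.powerset_mono.2 h)

theorem isIndepFor_map [DecidableEq W] (φ : V ↪ W) {E : Finset (V × V)} {S : Finset V} :
    IsIndepFor (E.image (Prod.map φ φ)) (S.map φ) ↔ IsIndepFor E S := by
  simp only [IsIndepFor, Finset.forall_mem_image, Prod.map_fst, Prod.map_snd,
    Finset.mem_map']

theorem restrictedZ_map [DecidableEq W] (φ : V ↪ W) (U : Finset V) (E : Finset (V × V)) :
    restrictedZ lam (U.map φ) (E.image (Prod.map φ φ)) = restrictedZ lam U E := by
  symm
  refine Finset.sum_bij (fun S _ => S.map φ) ?_ ?_ ?_ ?_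
  · intro S hS
    simpa [isIndepFor_map] using hS
  · intro S _ S' _ h
    exact Finset.map_injective φ h
  · intro S hS
    simp only [Finset.mem_filter, Finset.mem_powerset] at hS
    obtain ⟨S, hSU, rfl⟩ := Finset.subset_map_iff.1 hS.1
    exact ⟨S, by simpa [hSU] using (isIndepFor_map φ).1 hS.2, rfl⟩
  · simp

variable [DecidableEq V]

theorem isIndepFor_insert {E : Finset (V × V)} {S : Finset V} {e : V × V} :
    IsIndepFor (insert e E) S ↔ ¬(e.1 ∈ S ∧ e.2 ∈ S) ∧ IsIndepFor E S :=
  Finset.forall_mem_insert _ _ _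

theorem restrictedZ_mul_le (hlam : 0 ≤ lam) {U U' : Finset V} (hd : Disjoint U U')
    {E : Finset (V × V)}
    (hE : ∀ e ∈ E, ¬(e.1 ∈ U ∧ e.2 ∈ U') ∧ ¬(e.1 ∈ U' ∧ e.2 ∈ U)) :
    restrictedZ lam U E * restrictedZ lam U' E ≤ restrictedZ lam (U ∪ U') E := by
  unfold restrictedZ
  rw [Finset.sum_mul_sum, ← Finset.sum_product']
  have hinj : Set.InjOn (fun p : Finset V × Finset V => p.1 ∪ p.2)
      (((U.powerset.filter (IsIndepFor E)) ×ˢ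
        (U'.powerset.filter (IsIndepFor E)) :
          Finset (Finset V × Finset V)) : Set (Finset V × Finset V)) := by
    rintro ⟨A, B⟩ h ⟨A', B'⟩ h' heq
    simp only [Finset.coe_product, Finset.coe_filter, Finset.mem_powerset, Set.mem_prod,
      Set.mem_ofPred_eq] at h h' heq
    have hA : ∀ {A B}, A ⊆ U → B ⊆ U' → (A ∪ B) ∩ U = A := fun {A B} hA hB => by
      rw [Finset.union_inter_distrib_right, Finset.inter_eq_left.2 hA,
        Finset.disjoint_iff_inter_eq_empty.1 (hd.symm.mono_left hB), Finset.union_empty]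
    have hB : ∀ {A B}, A ⊆ U → B ⊆ U' → (A ∪ B) ∩ U' = B := fun {A B} hA hB => by
      rw [Finset.union_inter_distrib_right, Finset.inter_eq_left.2 hB,
        Finset.disjoint_iff_inter_eq_empty.1 (hd.mono_left hA), Finset.empty_union]
    refine Prod.ext ?_ ?_
    · exact (hA h.1.1 h.2.1).symm.trans ((congrArg (· ∩ U) heq).trans (hA h'.1.1 h'.2.1))
    · exact (hB h.1.1 h.2.1).symm.trans ((congrArg (· ∩ U') heq).trans (hB h'.1.1 h'.2.1))
  calc _ = ∑ p ∈ ((U.powerset.filter (IsIndepFor E)) ×ˢ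
        (U'.powerset.filter (IsIndepFor E))), lam ^ (p.1 ∪ p.2).card := by
        refine Finset.sum_congr rfl fun p hp => ?_
        simp only [Finset.mem_product, Finset.mem_filter, Finset.mem_powerset] at hp
        rw [Finset.card_union_of_disjoint (hd.mono hp.1.1 hp.2.1), pow_add]
    _ = ∑ S ∈ Finset.image (fun p : Finset V × Finset V => p.1 ∪ p.2)
        ((U.powerset.filter (IsIndepFor E)) ×ˢ
        (U'.powerset.filter (IsIndepFor E))), lam ^ S.card :=
        (Finset.sum_image (f := fun S : Finset V => lam ^ S.card) hinj).symm
    _ ≤ _ := by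
        refine Finset.sum_le_sum_of_subset_of_nonneg ?_ fun S _ _ => by positivity
        intro S hS
        simp only [Finset.mem_image, Finset.mem_product, Finset.mem_filter,
          Finset.mem_powerset] at hS ⊢
        obtain ⟨⟨A, B⟩, ⟨⟨hA, hAi⟩, hB, hBi⟩, rfl⟩ := hS
        refine ⟨Finset.union_subset_union hA hB, fun e he => ?_⟩
        have h₁ := hE e he
        have h₂ := hAi e he
        have h₃ := hBi e he
        simp only [Finset.mem_union] at *
        have := @hA e.1
        have := @hA e.2
        have := @hB e.1
        have := @hB e.2
        tauto

theorem sum_log_restrictedZ_le (hlam : 0 ≤ lam) {κ : Type*} [DecidableEq κ] (β : V → κ)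
    (U : κ → Finset V) (hU : ∀ b, ∀ v ∈ U b, β v = b) {E : Finset (V × V)}
    (hE : ∀ e ∈ E, β e.1 = β e.2) (s : Finset κ) :
    ∑ b ∈ s, Real.log (restrictedZ lam (U b) E) ≤ Real.log (restrictedZ lam (s.biUnion U) E) := by
  induction s using Finset.induction_on with
  | empty => simpa using Real.log_nonneg (one_le_restrictedZ hlam _ E)
  | insert b s hb ih =>
    have hpos : ∀ U : Finset V, 0 < restrictedZ lam U E := fun U =>
      zero_lt_one.trans_le (one_le_restrictedZ hlam U E)
    rw [Finset.sum_insert hb, Finset.biUnion_insert]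
    refine (add_le_add_right ih _).trans ?_
    rw [← Real.log_mul (hpos _).ne' (hpos _).ne']
    have hb' : ∀ v ∈ s.biUnion U, β v ≠ b := fun v hv => by
      obtain ⟨b', hb's, hv⟩ := Finset.mem_biUnion.1 hv
      rw [hU _ _ hv]
      rintro rfl
      exact hb hb's
    refine Real.log_le_log (mul_pos (hpos _) (hpos _)) (restrictedZ_mul_le hlam ?_ ?_)
    · exact Finset.disjoint_left.2 fun v hv hv' => hb' v hv' (hU _ _ hv)
    · refine fun e he => ⟨fun h => hb' _ h.2 ?_, fun h => hb' _ h.1 ?_⟩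
      · rw [← hE e he, hU _ _ h.1]
      · rw [hE e he, hU _ _ h.2]

theorem restrictedZ_insert_of_notMem {U : Finset V} {E : Finset (V × V)} {e : V × V}
    (he : e ∉ U ×ˢ U) : restrictedZ lam U (insert e E) = restrictedZ lam U E := by
  unfold restrictedZ
  congr 1
  refine Finset.filter_congr fun S hS => ?_
  rw [Finset.mem_powerset] at hS
  rw [isIndepFor_insert, and_iff_right]
  rintro ⟨h₁, h₂⟩
  exact he (Finset.mem_product.2 ⟨hS h₁, hS h₂⟩)

theorem restrictedZ_insert_le (hlam : 0 ≤ lam) (U : Finset V) (E : Finset (V × V)) (e : V × V) :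
    restrictedZ lam U (insert e E) ≤ restrictedZ lam U E := by
  refine Finset.sum_le_sum_of_subset_of_nonneg ?_ fun S _ _ => by positivity
  exact Finset.monotone_filter_right _ fun S _ hS => (isIndepFor_insert.1 hS).2

theorem restrictedZ_le_mul_insert (hlam : 0 ≤ lam) (U : Finset V) (E : Finset (V × V))
    (e : V × V) :
    restrictedZ lam U E ≤ (1 + lam) * restrictedZ lam U (insert e E) := by
  have hnot : ∑ S ∈ U.powerset with IsIndepFor E S ∧ ¬(e.1 ∈ S ∧ e.2 ∈ S), lam ^ S.card =
      restrictedZ lam U (insert e E) := by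
    simp only [restrictedZ, isIndepFor_insert, and_comm]
  have hboth : ∑ S ∈ U.powerset with IsIndepFor E S ∧ (e.1 ∈ S ∧ e.2 ∈ S), lam ^ S.card ≤
      lam * restrictedZ lam U (insert e E) := by
    calc _ = ∑ S ∈ U.powerset with IsIndepFor E S ∧ (e.1 ∈ S ∧ e.2 ∈ S),
          lam * lam ^ (S.erase e.1).card := by
          refine Finset.sum_congr rfl fun S hS => ?_
          rw [← pow_succ', Finset.card_erase_add_one (Finset.mem_filter.1 hS).2.2.1]
      _ ≤ _ := by
        rw [restrictedZ, Finset.mul_sum,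
          ← Finset.sum_image (f := fun S : Finset V => lam * lam ^ S.card)
            (g := fun S : Finset V => S.erase e.1)]
        · refine Finset.sum_le_sum_of_subset_of_nonneg ?_ fun S _ _ => by positivity
          intro S hS
          obtain ⟨S, hSE, rfl⟩ := Finset.mem_image.1 hS
          obtain ⟨hSU, hSE, -⟩ := Finset.mem_filter.1 hSE
          refine Finset.mem_filter.2 ⟨Finset.mem_powerset.2
            ((Finset.erase_subset _ _).trans (Finset.mem_powerset.1 hSU)),
            isIndepFor_insert.2 ⟨by simp, fun e' he' h => ?_⟩⟩
          exact hSE e' he' ⟨Finset.mem_of_mem_erase h.1, Finset.mem_of_mem_erase h.2⟩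
        · intro S hS S' hS' h
          have hS := (Finset.mem_filter.1 hS).2.2.1
          have hS' := (Finset.mem_filter.1 hS').2.2.1
          rw [← Finset.insert_erase hS, ← Finset.insert_erase hS']
          exact congrArg (insert e.1) h
  have hsplit := Finset.sum_filter_add_sum_filter_not (U.powerset.filter (IsIndepFor E))
    (fun S => e.1 ∈ S ∧ e.2 ∈ S) (fun S : Finset V => lam ^ S.card)
  rw [Finset.filter_filter, Finset.filter_filter, hnot] at hsplit
  rw [restrictedZ, ← hsplit]
  linarith

theorem abs_log_restrictedZ_insert_sub_le (hlam : 0 ≤ lam) (U : Finset V) (e : V × V)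
    (E : Finset (V × V)) :
    |Real.log (restrictedZ lam U (insert e E)) - Real.log (restrictedZ lam U E)| ≤
      Real.log (1 + lam) := by
  have hpos : ∀ E : Finset (V × V), 0 < restrictedZ lam U E := fun E =>
    zero_lt_one.trans_le (one_le_restrictedZ hlam _ E)
  have h₁ := Real.log_le_log (hpos _) (restrictedZ_insert_le hlam U E e)
  have h₂ := Real.log_le_log (hpos _) (restrictedZ_le_mul_insert hlam U E e)
  rw [Real.log_mul (by positivity) (hpos _).ne'] at h₂
  rw [abs_le]
  have := Real.log_nonneg (by linarith : 1 ≤ 1 + lam)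
  constructor <;> linarith

theorem restrictedZ_sub_insert [Fintype V] (E : Finset (V × V)) (i j : V) :
    restrictedZ lam Finset.univ E - restrictedZ lam Finset.univ (insert (i, j) E) =
      ∑ S : Finset V, (if IsIndepFor E S then lam ^ S.card else 0) *
        ((if i ∈ S then 1 else 0) * (if j ∈ S then 1 else 0)) := by
  unfold restrictedZ
  rw [Finset.powerset_univ, Finset.sum_filter, Finset.sum_filter, ← Finset.sum_sub_distrib]
  refine Finset.sum_congr rfl fun S _ => ?_
  simp only [isIndepFor_insert]
  by_cases h₁ : i ∈ S <;> by_cases h₂ : j ∈ S <;> simp [h₁, h₂]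

end RestrictedZ

section Interpolation

variable {V κ : Type*} [Fintype V] [DecidableEq κ]

/-- Edge weights of the disconnected model: the first endpoint is uniform, the second one is
uniform in the block of the first, where blocks are the fibres of `β`. -/
noncomputable def blockWeight (β : V → κ) (e : V × V) : ℝ :=
  if β e.1 = β e.2 then
    ((Fintype.card V : ℝ) * (Finset.univ.filter fun v => β v = β e.1).card)⁻¹ else 0

theorem blockWeight_nonneg (β : V → κ) (e : V × V) : 0 ≤ blockWeight β e := by
  unfold blockWeight
  split_ifs <;> positivity

theorem sum_blockWeight_mul_mul (β : V → κ) (f g : V → ℝ) :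
    ∑ e : V × V, blockWeight β e * (f e.1 * g e.2) =
      (Fintype.card V : ℝ)⁻¹ * ∑ b ∈ Finset.univ.image β,
        (∑ v with β v = b, f v) * (∑ v with β v = b, g v) /
          (Finset.univ.filter fun v => β v = b).card := by
  rw [Fintype.sum_prod_type, ← Finset.sum_fiberwise_of_maps_to (s := Finset.univ)
    (t := Finset.univ.image β) (g := β) (fun v hv => Finset.mem_image_of_mem β hv),
    Finset.mul_sum]
  refine Finset.sum_congr rfl fun b _ => ?_
  rw [Finset.sum_mul, Finset.sum_div, Finset.mul_sum]
  refine Finset.sum_congr rfl fun v hv => ?_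
  have hv : β v = b := (Finset.mem_filter.1 hv).2
  subst hv
  simp only [blockWeight, Finset.sum_filter (fun w => β w = β v), eq_comm (a := β v), ite_mul,
    zero_mul]
  rw [← Finset.sum_filter, ← Finset.sum_filter, ← Finset.mul_sum, ← Finset.mul_sum, mul_inv]
  ring

theorem sum_blockWeight [Nonempty V] (β : V → κ) : ∑ e : V × V, blockWeight β e = 1 := by
  have h := sum_blockWeight_mul_mul β (fun _ => 1) (fun _ => 1)
  simp only [mul_one, Finset.sum_const, nsmul_eq_mul, mul_self_div_self] at h
  rw [h, ← Nat.cast_sum, ← Finset.card_eq_sum_card_image, Finset.card_univ]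
  exact inv_mul_cancel₀ (by simp)

theorem sum_uniform_mul_mul_le (β : V → κ) (f : V → ℝ) :
    ∑ e : V × V, ((Fintype.card V : ℝ) ^ 2)⁻¹ * (f e.1 * f e.2) ≤
      ∑ e : V × V, blockWeight β e * (f e.1 * f e.2) := by
  have hpos : ∀ b ∈ Finset.univ.image β,
      (0 : ℝ) < (Finset.univ.filter fun v => β v = b).card := fun b hb => by
    obtain ⟨v, -, rfl⟩ := Finset.mem_image.1 hb
    exact_mod_cast Finset.card_pos.2 ⟨v, by simp⟩
  have h := Finset.sq_sum_div_le_sum_sq_div (Finset.univ.image β)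
    (fun b => ∑ v with β v = b, f v) hpos
  rw [Finset.sum_fiberwise_of_maps_to (fun v _ => Finset.mem_image_of_mem β (Finset.mem_univ v)),
    ← Nat.cast_sum, ← Finset.card_eq_sum_card_image, Finset.card_univ] at h
  rw [sum_blockWeight_mul_mul, ← Finset.mul_sum, Fintype.sum_prod_type]
  simp only [← pow_two, ← Finset.mul_sum, ← Finset.sum_mul]
  calc _ = (Fintype.card V : ℝ)⁻¹ * ((∑ v, f v) ^ 2 / Fintype.card V) := by
        rw [pow_two (Fintype.card V : ℝ), mul_inv]; ring
    _ ≤ _ := mul_le_mul_of_nonneg_left h (by positivity)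

theorem sum_uniform_gram_pow_le (β : V → κ) {ι : Type*} [Fintype ι] {w : ι → ℝ}
    (hw : ∀ a, 0 ≤ w a) (x : ι → V → ℝ) (k : ℕ) :
    ∑ e : V × V, ((Fintype.card V : ℝ) ^ 2)⁻¹ * (∑ a, w a * (x a e.1 * x a e.2)) ^ k ≤
      ∑ e : V × V, blockWeight β e * (∑ a, w a * (x a e.1 * x a e.2)) ^ k := by
  have h : ∀ μ : V × V → ℝ, ∑ e : V × V, μ e * (∑ a, w a * (x a e.1 * x a e.2)) ^ k =
      ∑ p : Fin k → ι, (∏ l, w (p l)) *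
        ∑ e : V × V, μ e * ((∏ l, x (p l) e.1) * ∏ l, x (p l) e.2) := fun μ => by
    simp only [Fintype.sum_pow, Finset.prod_mul_distrib, Finset.mul_sum]
    rw [Finset.sum_comm]
    exact Finset.sum_congr rfl fun p _ => Finset.sum_congr rfl fun e _ => mul_left_comm _ _ _
  rw [h (fun _ => _), h]
  exact Finset.sum_le_sum fun p _ => mul_le_mul_of_nonneg_left
    (sum_uniform_mul_mul_le β fun v => ∏ l, x (p l) v) (Finset.prod_nonneg fun l _ => hw _)

theorem sum_uniform_neg_log_le (β : V → κ) {ι : Type*} [Fintype ι] {w : ι → ℝ}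
    (hw : ∀ a, 0 ≤ w a) (x : ι → V → ℝ) (D : V × V → ℝ)
    (hD : ∀ e, D e = ∑ a, w a * (x a e.1 * x a e.2)) (hD1 : ∀ e, |D e| < 1) :
    ∑ e : V × V, ((Fintype.card V : ℝ) ^ 2)⁻¹ * -Real.log (1 - D e) ≤
      ∑ e : V × V, blockWeight β e * -Real.log (1 - D e) := by
  have hsum : ∀ μ : V × V → ℝ, HasSum (fun k : ℕ => ∑ e, μ e * (D e ^ (k + 1) / (k + 1)))
      (∑ e, μ e * -Real.log (1 - D e)) := fun μ =>
    hasSum_sum fun e _ => (Real.hasSum_pow_div_log_of_abs_lt_one (hD1 e)).mul_left (μ e)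
  refine hasSum_le (fun k => ?_) (hsum _) (hsum _)
  simp only [← mul_div_assoc, ← Finset.sum_div, hD]
  exact div_le_div_of_nonneg_right (sum_uniform_gram_pow_le β hw x (k + 1)) (by positivity)

theorem sum_uniformWeight [Nonempty V] : ∑ _e : V × V, ((Fintype.card V : ℝ) ^ 2)⁻¹ = 1 := by
  rw [Finset.sum_const, Finset.card_univ, Fintype.card_prod, nsmul_eq_mul, Nat.cast_mul, ← pow_two]
  exact mul_inv_cancel₀ (by simp)

variable [DecidableEq V] [Nonempty V] {lam : ℝ}

theorem insertAvg_blockWeight_log_le (hlam : 0 ≤ lam) (β : V → κ) :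
    insertAvg (blockWeight β) (fun E => Real.log (restrictedZ lam (Finset.univ : Finset V) E)) ≤
      insertAvg (fun _ => ((Fintype.card V : ℝ) ^ 2)⁻¹)
        (fun E => Real.log (restrictedZ lam (Finset.univ : Finset V) E)) := by
  intro E
  have hpos : ∀ E : Finset (V × V), 0 < restrictedZ lam Finset.univ E := fun E =>
    zero_lt_one.trans_le (one_le_restrictedZ hlam _ E)
  set Z := restrictedZ lam (Finset.univ : Finset V) E with hZ
  set D : V × V → ℝ := fun e => 1 - restrictedZ lam Finset.univ (insert e E) / Z with hDdef
  have hlog : ∀ e, Real.log (restrictedZ lam Finset.univ (insert e E)) =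
      Real.log Z - -Real.log (1 - D e) := fun e => by
    simp only [hDdef, sub_sub_cancel]
    rw [Real.log_div (hpos _).ne' (hpos _).ne']
    ring
  have key := sum_uniform_neg_log_le β (ι := Finset V)
    (w := fun S => (if IsIndepFor E S then lam ^ S.card else 0) / Z)
    (fun S => by have := (hpos E).le; split_ifs <;> positivity)
    (fun S v => if v ∈ S then 1 else 0) D (fun e => ?_) (fun e => ?_)
  · simp only [insertAvg_apply, hlog, mul_sub (_ : ℝ) (Real.log Z), Finset.sum_sub_distrib,
      ← Finset.sum_mul, sum_blockWeight, sum_uniformWeight]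
    exact sub_le_sub_left key _
  · simp only [div_mul_eq_mul_div, ← Finset.sum_div]
    rw [← restrictedZ_sub_insert E e.1 e.2, sub_div, ← hZ, div_self (hpos E).ne']
  · have h₁ : 0 < restrictedZ lam Finset.univ (insert e E) / Z := div_pos (hpos _) (hpos _)
    have h₂ : restrictedZ lam Finset.univ (insert e E) / Z ≤ 1 :=
      (div_le_one (hpos _)).2 (restrictedZ_insert_le hlam _ E e)
    simp only [hDdef, abs_lt]
    constructor <;> linarith

theorem insertAvg_blockWeight_restricted (β : V → κ) {b : κ} {U : Finset V}
    (hU : ∀ v, v ∈ U ↔ β v = b) (hne : U.Nonempty) :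
    insertAvg (blockWeight β) (fun E => Real.log (restrictedZ lam U E)) =
      ((U.card / Fintype.card V : ℝ) •
          insertAvg (fun e => if e ∈ U ×ˢ U then ((U.card : ℝ) ^ 2)⁻¹ else 0) +
        (1 - U.card / Fintype.card V : ℝ) • (1 : Module.End ℝ (Finset (V × V) → ℝ)))
          (fun E => Real.log (restrictedZ lam U E)) := by
  ext E
  have hcard : (U.card : ℝ) ≠ 0 := by simpa using hne.ne_empty
  have hUsum : ∑ e : V × V, (if e ∈ U ×ˢ U then ((U.card : ℝ) ^ 2)⁻¹ else 0) = 1 := by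
    rw [Finset.sum_ite_mem, Finset.univ_inter, Finset.sum_const, Finset.card_product]
    simp only [nsmul_eq_mul, Nat.cast_mul]
    field_simp
  have hfil : U = Finset.univ.filter fun v => β v = b := by ext v; simp [hU]
  have hterm : ∀ e : V × V, blockWeight β e *
        (Real.log (restrictedZ lam U (insert e E)) - Real.log (restrictedZ lam U E)) =
      (U.card / Fintype.card V : ℝ) * ((if e ∈ U ×ˢ U then ((U.card : ℝ) ^ 2)⁻¹ else 0) *
        (Real.log (restrictedZ lam U (insert e E)) - Real.log (restrictedZ lam U E))) := fun e => by
    by_cases he : e ∈ U ×ˢ U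
    · have h := Finset.mem_product.1 he
      rw [hU, hU] at h
      rw [if_pos he, blockWeight, if_pos (h.1.trans h.2.symm), h.1, ← hfil, ← mul_assoc]
      congr 1
      field_simp
    · rw [restrictedZ_insert_of_notMem he]
      simp
  have h := Finset.sum_congr (rfl : (Finset.univ : Finset (V × V)) = _) fun e _ => hterm e
  simp only [← Finset.mul_sum, mul_sub, Finset.sum_sub_distrib, ← Finset.sum_mul, sum_blockWeight,
    hUsum] at h
  simp only [LinearMap.add_apply, LinearMap.smul_apply, Pi.add_apply, Pi.smul_apply, smul_eq_mul,
    Module.End.one_apply, insertAvg_apply]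
  linarith

end Interpolation

section Limit

/-- The expected log-partition function of `G(N, ⌊cN⌋)`. -/
noncomputable def meanLogZ (c lam : ℝ) (N : ℕ) : ℝ :=
  (insertAvg (fun _ : Fin N × Fin N => ((Fintype.card (Fin N) : ℝ) ^ 2)⁻¹) ^ ⌊c * (N : ℝ)⌋₊)
    (fun E => Real.log (restrictedZ lam Finset.univ E)) ∅

variable {c lam : ℝ}

theorem meanLogZ_nonneg (hlam : 0 ≤ lam) (N : ℕ) : 0 ≤ meanLogZ c lam N := by
  have := insertAvg_pow_mono (μ := fun _ : Fin N × Fin N => ((Fintype.card (Fin N) : ℝ) ^ 2)⁻¹)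
    (fun _ => by positivity) (f := 0) (g := fun E => Real.log (restrictedZ lam Finset.univ E))
    (fun E => Real.log_nonneg (one_le_restrictedZ hlam _ E)) ⌊c * (N : ℝ)⌋₊ ∅
  rwa [map_zero] at this

theorem meanLogZ_le (hlam : 0 ≤ lam) {N : ℕ} (hN : 1 ≤ N) :
    meanLogZ c lam N ≤ Real.log (1 + lam) * N := by
  have : Nonempty (Fin N) := ⟨⟨0, hN⟩⟩
  have := insertAvg_pow_mono (μ := fun _ : Fin N × Fin N => ((Fintype.card (Fin N) : ℝ) ^ 2)⁻¹)
    (fun _ => by positivity) (f := fun E => Real.log (restrictedZ lam Finset.univ E))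
    (g := fun _ => Real.log (1 + lam) * N) (fun E => ?_) ⌊c * (N : ℝ)⌋₊ ∅
  · rwa [insertAvg_pow_const sum_uniformWeight] at this
  · have h := Real.log_le_log (zero_lt_one.trans_le (one_le_restrictedZ hlam _ E))
      (restrictedZ_le hlam Finset.univ E)
    rw [Real.log_pow, Finset.card_univ, Fintype.card_fin] at h
    exact h.trans_eq (mul_comm _ _)

theorem insertAvg_pow_restrictedZ_map {V W : Type*} [Fintype V] [DecidableEq V] [Fintype W]
    [DecidableEq W] (φ : V ↪ W) (m : ℕ) :
    (insertAvg (fun e : W × W => if e ∈ Finset.univ.map φ ×ˢ Finset.univ.map φ then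
        (((Finset.univ.map φ).card : ℝ) ^ 2)⁻¹ else 0) ^ m)
      (fun E => Real.log (restrictedZ lam (Finset.univ.map φ) E)) ∅ =
    (insertAvg (fun _ : V × V => ((Fintype.card V : ℝ) ^ 2)⁻¹) ^ m)
      (fun E => Real.log (restrictedZ lam Finset.univ E)) ∅ := by
  have h := insertAvg_pow_image (μ := fun _ : V × V => ((Fintype.card V : ℝ) ^ 2)⁻¹)
    (ν := fun e : W × W => if e ∈ Finset.univ.map φ ×ˢ Finset.univ.map φ then
        (((Finset.univ.map φ).card : ℝ) ^ 2)⁻¹ else 0) (ψ := Prod.map φ φ) (fun F => ?_)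
    (fun E => Real.log (restrictedZ lam (Finset.univ.map φ) E)) m ∅
  · simpa only [Finset.image_empty, restrictedZ_map] using h
  · simp only [ite_mul, zero_mul, Finset.card_map, Finset.card_univ]
    rw [Finset.sum_ite_mem, Finset.univ_inter, Finset.sum_product, Fintype.sum_prod_type]
    simp only [Finset.sum_map, Prod.map]

theorem meanLogZ_superadditive (hc : 0 ≤ c) (hlam : 0 ≤ lam) {n N : ℕ} (hn : 1 ≤ n)
    (hN : 1 ≤ N) (hnN : n ≤ N) :
    ((N / n : ℕ) : ℝ) *
      (meanLogZ c lam n - Real.log (1 + lam) * (c / 2 + 3 / 2) * √n) ≤ meanLogZ c lam N := by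
  have : Nonempty (Fin N) := ⟨⟨0, hN⟩⟩
  set K := Real.log (1 + lam)
  have hK : 0 ≤ K := Real.log_nonneg (by linarith)
  have hn' : (1 : ℝ) ≤ n := by exact_mod_cast hn
  have hN' : (1 : ℝ) ≤ N := by exact_mod_cast hN
  have hnN' : (n : ℝ) ≤ N := by exact_mod_cast hnN
  set β : Fin N → ℕ := fun i => i / n with hβ
  set U : ℕ → Finset (Fin N) := fun b => Finset.univ.filter fun i => β i = b with hU
  set M := ⌊c * (N : ℝ)⌋₊ with hM
  have hblock : ∀ b ∈ Finset.range (N / n), meanLogZ c lam n - K * (c / 2 + 3 / 2) * √n ≤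
      (insertAvg (blockWeight β) ^ M) (fun E => Real.log (restrictedZ lam (U b) E)) ∅ := by
    intro b hb
    have hbn : b * n + n ≤ N := by
      have h₁ : (b + 1) * n ≤ N / n * n := Nat.mul_le_mul_right n (Finset.mem_range.1 hb)
      have h₂ := Nat.div_mul_le_self N n
      linarith [add_one_mul b n]
    let φ : Fin n ↪ Fin N :=
      ⟨fun l => ⟨b * n + l, by omega⟩, fun l l' h => by simpa [Fin.ext_iff] using h⟩
    have hφU : U b = Finset.univ.map φ := by
      ext i
      simp only [hU, hβ, Finset.mem_filter, Finset.mem_univ, true_and, Finset.mem_map]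
      constructor
      · rintro rfl
        refine ⟨⟨i % n, Nat.mod_lt _ hn⟩, Fin.ext ?_⟩
        exact Nat.div_add_mod' i n
      · rintro ⟨l, rfl⟩
        change (b * n + l) / n = b
        rw [mul_comm, Nat.mul_add_div hn, Nat.div_eq_of_lt l.2, add_zero]
    have hcard : (U b).card = n := by rw [hφU, Finset.card_map, Finset.card_univ, Fintype.card_fin]
    have hne : (U b).Nonempty := Finset.card_pos.1 (by omega)
    have hUsum : ∑ e : Fin N × Fin N,
        (if e ∈ U b ×ˢ U b then (((U b).card : ℝ) ^ 2)⁻¹ else 0) = 1 := by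
      rw [Finset.sum_ite_mem, Finset.univ_inter, Finset.sum_const, Finset.card_product, hcard]
      simp only [nsmul_eq_mul, Nat.cast_mul]
      field_simp
    have hcomm : Commute (insertAvg (blockWeight β))
        (((U b).card / Fintype.card (Fin N) : ℝ) •
          insertAvg (fun e => if e ∈ U b ×ˢ U b then (((U b).card : ℝ) ^ 2)⁻¹ else 0) +
        (1 - (U b).card / Fintype.card (Fin N) : ℝ) •
          (1 : Module.End ℝ (Finset (Fin N × Fin N) → ℝ))) :=
      ((insertAvg_commute _ _).smul_right _).add_right ((Commute.one_right _).smul_right _)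
    rw [pow_apply_eq_pow_apply_of_commute hcomm
      (insertAvg_blockWeight_restricted β (b := b) (by simp [hU]) hne)]
    have hp1 : ((U b).card / Fintype.card (Fin N) : ℝ) ≤ 1 := by
      rw [hcard, Fintype.card_fin]
      exact div_le_one_of_le₀ hnN' (by positivity)
    have hlazy := lazy_insertAvg_pow_ge
      (μ := fun e => if e ∈ U b ×ˢ U b then (((U b).card : ℝ) ^ 2)⁻¹ else 0)
      (g := fun E => Real.log (restrictedZ lam (U b) E))
      (fun e => by split_ifs <;> positivity) hUsum hK
      (abs_log_restrictedZ_insert_sub_le hlam (U b)) (by positivity) hp1 M ⌊c * (n : ℝ)⌋₊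
      (s := √n) (by positivity) ∅
    refine le_trans ?_ hlazy
    have hmean : (insertAvg (fun e => if e ∈ U b ×ˢ U b then (((U b).card : ℝ) ^ 2)⁻¹ else 0) ^
        ⌊c * (n : ℝ)⌋₊) (fun E => Real.log (restrictedZ lam (U b) E)) ∅ = meanLogZ c lam n := by
      rw [hφU, insertAvg_pow_restrictedZ_map, meanLogZ]
    rw [hmean, hcard, Fintype.card_fin, mul_assoc K]
    refine sub_le_sub_left (mul_le_mul_of_nonneg_left ?_ hK) _
    have hs : √(n : ℝ) * √n = n := Real.mul_self_sqrt (by positivity)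
    have hs1 : 1 ≤ √(n : ℝ) := Real.one_le_sqrt.2 hn'
    have hMle : (M : ℝ) ≤ c * N := Nat.floor_le (by positivity)
    have hMlt : c * N - 1 < M := Nat.sub_one_lt_floor _
    have hmle : (⌊c * (n : ℝ)⌋₊ : ℝ) ≤ c * n := Nat.floor_le (by positivity)
    have hmlt : c * n - 1 < (⌊c * (n : ℝ)⌋₊ : ℝ) := Nat.sub_one_lt_floor _
    have hMp : M * (n / N : ℝ) ≤ c * n := by
      calc M * (n / N : ℝ) ≤ c * N * (n / N) := by gcongr
        _ = c * n := by field_simp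
    have hMp' : c * n - 1 ≤ M * (n / N : ℝ) := by
      have h₁ : (n / N : ℝ) ≤ 1 := div_le_one_of_le₀ hnN' (by positivity)
      calc c * n - 1 ≤ (c * N - 1) * (n / N) := by
            rw [sub_mul, one_mul, mul_assoc, mul_div_cancel₀ _ (by positivity)]; linarith
        _ ≤ _ := by gcongr
    have h₁ : M * (n / N : ℝ) / (2 * √n) ≤ c / 2 * √n := by
      rw [div_le_iff₀ (by positivity)]
      calc _ ≤ c * n := hMp
        _ = c / 2 * √n * (2 * √n) := by linear_combination (-c) * hs
    have h₂ : |M * (n / N : ℝ) - ⌊c * (n : ℝ)⌋₊| ≤ 1 := abs_le.2 ⟨by linarith, by linarith⟩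
    linarith
  have hmono := insertAvg_pow_mono_on (blockWeight_nonneg β)
    (Q := fun e => β e.1 = β e.2)
    (fun e he => by by_contra h; exact he (if_neg h))
    (f := ∑ b ∈ Finset.range (N / n), fun E => Real.log (restrictedZ lam (U b) E))
    (g := fun E => Real.log (restrictedZ lam Finset.univ E)) (fun E hE => by
      rw [Finset.sum_apply]
      refine (sum_log_restrictedZ_le hlam β U (by simp [hU]) hE _).trans ?_
      exact Real.log_le_log (zero_lt_one.trans_le (one_le_restrictedZ hlam _ E))
        (restrictedZ_mono hlam (Finset.subset_univ _) E)) M ∅ (by simp)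
  rw [map_sum, Finset.sum_apply] at hmono
  have hfull := insertAvg_pow_le_insertAvg_pow (fun _ => by positivity) (blockWeight_nonneg β)
    (insertAvg_blockWeight_log_le hlam β) M ∅
  have hsum := Finset.sum_le_sum hblock
  rw [Finset.sum_const, Finset.card_range, nsmul_eq_mul] at hsum
  exact hsum.trans (hmono.trans hfull)

/-- A variant of Fekete's lemma for superadditivity up to a square-root error. -/
theorem exists_tendsto_div_of_superadditive_sqrt {a : ℕ → ℝ} {B C : ℝ} (hC : 0 ≤ C)
    (h0 : ∀ n, 0 ≤ a n) (hB : ∀ n, 1 ≤ n → a n ≤ B * n)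
    (h : ∀ n N, 1 ≤ n → n ≤ N → ((N / n : ℕ) : ℝ) * (a n - C * √n) ≤ a N) :
    ∃ z, Tendsto (fun N => a N / N) atTop (nhds z) := by
  set u : ℕ → ℝ := fun n => (a (n + 1) - C * √((n + 1 : ℕ) : ℝ)) / (n + 1 : ℕ) with hu
  have hbdd : BddAbove (Set.range u) := by
    refine ⟨B, ?_⟩
    rintro _ ⟨n, rfl⟩
    rw [hu, div_le_iff₀ (by positivity)]
    have := hB (n + 1) (by omega)
    have : 0 ≤ C * √((n + 1 : ℕ) : ℝ) := by positivity
    linarith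
  refine ⟨⨆ n, u n, tendsto_order.2 ⟨fun x hx => ?_, fun x hx => ?_⟩⟩
  · obtain ⟨n, hn⟩ := exists_lt_of_lt_ciSup hx
    by_cases hun : u n ≤ 0
    · exact Eventually.of_forall fun N => (hn.trans_le hun).trans_le
        (div_nonneg (h0 N) (Nat.cast_nonneg N))
    push Not at hun
    have hlim : Tendsto (fun N : ℕ => (1 - ((n + 1 : ℕ) : ℝ) / N) * u n) atTop (nhds (u n)) := by
      have := ((tendsto_const_div_atTop_nhds_zero_nat ((n + 1 : ℕ) : ℝ)).const_sub 1).mul_const (u n)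
      simpa using this
    filter_upwards [(tendsto_order.1 hlim).1 x hn, eventually_ge_atTop (n + 1)] with N hN hnN
    refine hN.trans_le ?_
    have hNpos : (0 : ℝ) < N := by exact_mod_cast (Nat.succ_pos n).trans_le hnN
    rw [le_div_iff₀ hNpos]
    refine le_trans ?_ (h (n + 1) N (by omega) hnN)
    have h₁ : a (n + 1) - C * √((n + 1 : ℕ) : ℝ) = ((n + 1 : ℕ) : ℝ) * u n := by
      simp only [hu]; field_simp
    have h₂ : (N : ℝ) - (n + 1 : ℕ) ≤ ((N / (n + 1) : ℕ) : ℝ) * (n + 1 : ℕ) := by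
      have := Nat.lt_div_mul_add (a := N) (b := n + 1) (Nat.succ_pos n)
      have : (N : ℝ) < ((N / (n + 1) : ℕ) : ℝ) * (n + 1 : ℕ) + (n + 1 : ℕ) := by exact_mod_cast this
      linarith
    rw [h₁, ← mul_assoc]
    calc (1 - ((n + 1 : ℕ) : ℝ) / N) * u n * N = ((N : ℝ) - (n + 1 : ℕ)) * u n := by
          field_simp
      _ ≤ _ := mul_le_mul_of_nonneg_right h₂ hun.le
  · have hlim : Tendsto (fun N : ℕ => (⨆ n, u n) + C * (√(N : ℝ))⁻¹) atTop
        (nhds (⨆ n, u n)) := by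
      have := ((tendsto_inv_atTop_zero.comp
        (Real.tendsto_sqrt_atTop.comp tendsto_natCast_atTop_atTop)).const_mul C).const_add
          (⨆ n, u n)
      simpa using this
    filter_upwards [(tendsto_order.1 hlim).2 x hx, eventually_ge_atTop 1] with N hN hN1
    refine lt_of_le_of_lt ?_ hN
    obtain ⟨n, rfl⟩ := Nat.exists_eq_add_of_le' hN1
    have h₁ := le_ciSup hbdd n
    have hs : √((n + 1 : ℕ) : ℝ) / (n + 1 : ℕ) = (√((n + 1 : ℕ) : ℝ))⁻¹ :=
      Real.sqrt_div_self'.trans (one_div _)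
    have h₂ : u n = a (n + 1) / (n + 1 : ℕ) - C * (√((n + 1 : ℕ) : ℝ))⁻¹ := by
      rw [← hs]; simp only [hu]; ring
    linarith

theorem probER_abs_log_sub_le (hc : 0 ≤ c) (hlam : 0 ≤ lam) {N : ℕ} (hN : 1 ≤ N) {δ : ℝ}
    (hδ : 0 < δ) :
    probER N ⌊c * (N : ℝ)⌋₊
        (fun E => δ * N < |Real.log (hardCoreZ lam E) - meanLogZ c lam N|) ≤
      c * Real.log (1 + lam) ^ 2 / δ ^ 2 / N := by
  have : Nonempty (Fin N) := ⟨⟨0, hN⟩⟩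
  have hNpos : (0 : ℝ) < N := by exact_mod_cast hN
  set M := ⌊c * (N : ℝ)⌋₊ with hM
  set a := meanLogZ c lam N with ha
  have hvar := insertAvg_pow_sub_mean_sq_le
    (μ := fun _ : Fin N × Fin N => ((Fintype.card (Fin N) : ℝ) ^ 2)⁻¹)
    (g := fun E => Real.log (restrictedZ lam Finset.univ E))
    (fun _ => by positivity) sum_uniformWeight
    (abs_log_restrictedZ_insert_sub_le hlam Finset.univ) M ∅
  change (insertAvg _ ^ M) (fun E => (_ - a) ^ 2) ∅ ≤ _ at hvar
  rw [insertAvg_const_pow_eq_sum] at hvar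
  simp only [Finset.empty_union, ← hardCoreZ_eq_restrictedZ] at hvar
  have hcard : (Fintype.card (Fin M → Fin N × Fin N) : ℝ)⁻¹ =
      (((Fintype.card (Fin N) : ℝ) ^ 2)⁻¹) ^ M := by
    rw [Fintype.card_fun, Fintype.card_fin, Fintype.card_prod, inv_pow, pow_two]
    push_cast
    rfl
  have hcheb : (((Finset.univ : Finset (Fin M → Fin N × Fin N)).filter fun E =>
        δ * N < |Real.log (hardCoreZ lam E) - a|).card : ℝ) * (δ * N) ^ 2 ≤
      ∑ E : Fin M → Fin N × Fin N, (Real.log (hardCoreZ lam E) - a) ^ 2 := by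
    rw [← nsmul_eq_mul]
    refine (Finset.card_nsmul_le_sum _ _ _ fun E hE => ?_).trans
      (Finset.sum_le_sum_of_subset_of_nonneg (Finset.filter_subset _ _) fun _ _ _ => sq_nonneg _)
    rw [← sq_abs (_ - a)]
    have := (Finset.mem_filter.1 hE).2
    gcongr
  have hMle : (M : ℝ) ≤ c * N := Nat.floor_le (by positivity)
  rw [probER, div_eq_inv_mul, hcard, div_div, le_div_iff₀ (by positivity)]
  refine le_of_mul_le_mul_right ?_ hNpos
  calc _ = (((Fintype.card (Fin N) : ℝ) ^ 2)⁻¹) ^ M *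
        ((((Finset.univ : Finset (Fin M → Fin N × Fin N)).filter fun E =>
          δ * N < |Real.log (hardCoreZ lam E) - a|).card : ℝ) * (δ * N) ^ 2) := by ring
    _ ≤ (((Fintype.card (Fin N) : ℝ) ^ 2)⁻¹) ^ M *
        ∑ E : Fin M → Fin N × Fin N, (Real.log (hardCoreZ lam E) - a) ^ 2 := by gcongr
    _ ≤ M * Real.log (1 + lam) ^ 2 := hvar
    _ ≤ c * N * Real.log (1 + lam) ^ 2 := by gcongr
    _ = _ := by ring

theorem probER_nonneg {N M : ℕ} (p : (Fin M → Fin N × Fin N) → Prop) : 0 ≤ probER N M p := by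
  unfold probER
  positivity

theorem probER_mono {N M : ℕ} {p q : (Fin M → Fin N × Fin N) → Prop} (h : ∀ E, p E → q E) :
    probER N M p ≤ probER N M q := by
  unfold probER
  gcongr
  exact h _

end Limit

/-- For the Erdős–Rényi multigraph `G(N, ⌊cN⌋)` and `λ ≥ 1`, the log-partition function
of the hard-core model, normalized by `N`, converges with high probability to a constant
`z(c)`. -/
theorem hard_core_logZ_scaling_limit_ER (c lam : ℝ) (hc : 0 < c) (hlam : 1 ≤ lam) :
    ∃ z : ℝ,
      ∀ ε : ℝ, 0 < ε →
        Tendsto (fun N : ℕ =>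
            probER N ⌊c * (N : ℝ)⌋₊
              (fun E => ε < |Real.log (hardCoreZ lam E) / (N : ℝ) - z|))
          atTop (nhds 0) := by
  have hlam0 : 0 ≤ lam := zero_le_one.trans hlam
  have hK : 0 ≤ Real.log (1 + lam) := Real.log_nonneg (by linarith)
  obtain ⟨z, hz⟩ := exists_tendsto_div_of_superadditive_sqrt
    (a := meanLogZ c lam) (B := Real.log (1 + lam)) (C := Real.log (1 + lam) * (c / 2 + 3 / 2))
    (by positivity) (meanLogZ_nonneg hlam0) (fun n hn => meanLogZ_le hlam0 hn)
    (fun n N hn hnN => meanLogZ_superadditive hc.le hlam0 hn (hn.trans hnN) hnN)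
  refine ⟨z, fun ε hε => ?_⟩
  refine squeeze_zero' (Eventually.of_forall fun N => probER_nonneg _) ?_
    (tendsto_const_div_atTop_nhds_zero_nat (c * Real.log (1 + lam) ^ 2 / (ε / 2) ^ 2))
  filter_upwards [eventually_ge_atTop 1, Metric.tendsto_nhds.1 hz (ε / 2) (half_pos hε)]
    with N hN hzN
  refine (probER_mono fun E hE => ?_).trans (probER_abs_log_sub_le hc.le hlam0 hN (half_pos hε))
  have hNpos : (0 : ℝ) < N := by exact_mod_cast hN
  rw [Real.dist_eq] at hzN
  have hdiv : |Real.log (hardCoreZ lam E) / N - meanLogZ c lam N / N| =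
      |Real.log (hardCoreZ lam E) - meanLogZ c lam N| / N := by
    rw [← sub_div, abs_div, Nat.abs_cast]
  rw [← lt_div_iff₀ hNpos, ← hdiv]
  have := abs_sub_le (Real.log (hardCoreZ lam E) / N) (meanLogZ c lam N / N) z
  linarith
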